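/- Let B be an n×n complex Hermitian matrix and let p, q be integers with 1 ≤ p < q < n. Suppose every principal minor of B of order p is nonzero, every principal minor of order q is nonzero, and B has both a positive and a negative principal minor of order q. Then there exists a p-element subset α ⊆ {1,…,n} such that B[α] is invertible and the Schur complement C = B/B[α] (an (n−p)×(n−p) Hermitian matrix) satisfies: every principal minor of C of order q−p is nonzero, and C has both a positive and a negative principal minor of order q−p. -/

import Mathlib

/-- The principal minor of a complex matrix `B` (over an arbitrary finite index type)
indexed by the subset `α` (as a real number; for Hermitian matrices all principal
minors are real). -/
noncomputable def pminorG {m : Type*} [Fintype m] [DecidableEq m]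
    (B : Matrix m m ℂ) (α : Finset m) : ℝ :=
  (Matrix.det (fun i j : α => B i j)).re

/-- The Schur complement B/B[α] of the principal submatrix `B[α]` in `B`, indexed by the
complement of `α`. -/
noncomputable def schurCompl {n : ℕ} (B : Matrix (Fin n) (Fin n) ℂ) (α : Finset (Fin n)) :
    Matrix ↥(αᶜ) ↥(αᶜ) ℂ :=
  (Matrix.of fun i j : ↥(αᶜ) => B i j) -
    (Matrix.of fun (i : ↥(αᶜ)) (a : ↥α) => B i a) *
      (Matrix.of fun a b : ↥α => B a b)⁻¹ *
        (Matrix.of fun (a : ↥α) (j : ↥(αᶜ)) => B a j)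

open Finset in
/-- A property of `q`-subsets that propagates between any two `q`-subsets containing a common
`p`-subset, for some `p < q`, propagates between all `q`-subsets. -/
theorem Finset.forall_card_eq_of_common_subset {ι : Type*} [DecidableEq ι] {p q : ℕ} (hpq : p < q)
    {P : Finset ι → Prop}
    (hP : ∀ α γ δ : Finset ι, #α = p → #γ = q → #δ = q → α ⊆ γ → α ⊆ δ → P γ → P δ)
    {γ δ : Finset ι} (hγ : #γ = q) (hδ : #δ = q) (h : P γ) : P δ := by
  induction hk : #(γ \ δ) generalizing γ with
  | zero =>
    have hsub : γ ⊆ δ := sdiff_eq_empty_iff_subset.mp (card_eq_zero.mp hk)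
    rwa [← eq_of_subset_of_card_le hsub (by omega)]
  | succ k ih =>
    obtain ⟨x, hx⟩ : (γ \ δ).Nonempty := card_pos.mp (by omega)
    obtain ⟨y, hy⟩ : (δ \ γ).Nonempty :=
      card_pos.mp (by rw [← card_sdiff_comm (hγ.trans hδ.symm)]; omega)
    rw [mem_sdiff] at hx hy
    obtain ⟨α, hα, hαp⟩ := exists_subset_card_eq (s := γ.erase x) (n := p)
      (by rw [card_erase_of_mem hx.1]; omega)
    have hcard : #(insert y (γ.erase x)) = q := by
      rw [card_insert_of_notMem (by simp [hy.2]), card_erase_of_mem hx.1]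
      omega
    refine ih hcard (hP α γ _ hαp hγ hcard (hα.trans (erase_subset _ _))
      (hα.trans (subset_insert _ _)) h) ?_
    rw [insert_sdiff_of_mem _ hy.1, erase_sdiff_comm, card_erase_of_mem (mem_sdiff.mpr hx), hk,
      Nat.add_sub_cancel]

/-- Principal minors of a Hermitian matrix are real. -/
theorem Matrix.IsHermitian.ofReal_pminorG {m : Type*} [Fintype m] [DecidableEq m]
    {B : Matrix m m ℂ} (hB : B.IsHermitian) (α : Finset m) :
    (pminorG B α : ℂ) = Matrix.det (Matrix.of fun i j : α => B i j) := by
  have h := Matrix.det_conjTranspose (Matrix.of fun i j : α => B i j)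
  rw [show (Matrix.of fun i j : α => B i j).conjTranspose = Matrix.of fun i j : α => B i j from
    Matrix.ext fun i j => hB.apply i j] at h
  exact Complex.conj_eq_iff_re.mp h.symm

/-- Schur's determinant formula for the principal minors of a Schur complement. -/
theorem det_schurCompl {n : ℕ} (B : Matrix (Fin n) (Fin n) ℂ) (α : Finset (Fin n))
    (hα : IsUnit (Matrix.det (Matrix.of fun a b : ↥α => B a b))) (β : Finset ↥(αᶜ))
    (γ : Finset (Fin n)) (hγ : γ = α ∪ β.map (Function.Embedding.subtype _)) :
    Matrix.det (Matrix.of fun i j : γ => B i j) =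
      Matrix.det (Matrix.of fun a b : ↥α => B a b) *
        Matrix.det (Matrix.of fun i j : β => schurCompl B α i j) := by
  let f : ↥α ⊕ ↥β → ↥γ := Sum.elim (fun a => ⟨a, by simp [hγ]⟩)
    (fun b => ⟨b.1.1, by
      rw [hγ]; exact Finset.mem_union_right _ (Finset.mem_map_of_mem _ b.2)⟩)
  have hf : Function.Bijective f := by
    constructor
    · rintro (⟨a, ha⟩ | ⟨⟨a, ha⟩, ha'⟩) (⟨b, hb⟩ | ⟨⟨b, hb⟩, hb'⟩) h <;>
        simp [f] at h ha hb ⊢ <;> grind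
    · rintro ⟨x, hx⟩
      rw [hγ] at hx
      rcases Finset.mem_union.mp hx with h | h
      · exact ⟨Sum.inl ⟨x, h⟩, rfl⟩
      · obtain ⟨b, hb, rfl⟩ := Finset.mem_map.mp h
        exact ⟨Sum.inr ⟨b, hb⟩, rfl⟩
  let := Matrix.invertibleOfIsUnitDet _ hα
  rw [← Matrix.det_submatrix_equiv_self (Equiv.ofBijective f hf),
    ← Matrix.fromBlocks_toBlocks (Matrix.submatrix _ _ _)]
  have h := Matrix.det_fromBlocks₁₁ (Matrix.of fun a b : ↥α => B a b)
    (Matrix.of fun (a : ↥α) (j : ↥β) => B a j) (Matrix.of fun (i : ↥β) (a : ↥α) => B i a)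
    (Matrix.of fun i j : ↥β => B i j)
  rw [Matrix.invOf_eq_nonsing_inv] at h
  exact h

theorem pminorG_eq_mul_pminorG_schurCompl {n : ℕ} {B : Matrix (Fin n) (Fin n) ℂ}
    (hB : B.IsHermitian) (α : Finset (Fin n))
    (hα : IsUnit (Matrix.det (Matrix.of fun a b : ↥α => B a b))) (β : Finset ↥(αᶜ))
    (γ : Finset (Fin n)) (hγ : γ = α ∪ β.map (Function.Embedding.subtype _)) :
    pminorG B γ = pminorG B α * pminorG (schurCompl B α) β := by
  have h := det_schurCompl B α hα β γ hγ
  rw [← hB.ofReal_pminorG, ← hB.ofReal_pminorG] at h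
  exact (congrArg Complex.re h).trans (Complex.re_ofReal_mul _ _)

/-- Schur-complement transfer of an A* term. -/
theorem schur_Astar {n : ℕ} (B : Matrix (Fin n) (Fin n) ℂ) (hB : B.IsHermitian)
    (p q : ℕ) (hp : 1 ≤ p) (hpq : p < q) (hq : q < n)
    (hAp : ∀ α : Finset (Fin n), α.card = p → pminorG B α ≠ 0)
    (hAq : ∀ α : Finset (Fin n), α.card = q → pminorG B α ≠ 0)
    (hpos : ∃ α : Finset (Fin n), α.card = q ∧ 0 < pminorG B α)
    (hneg : ∃ α : Finset (Fin n), α.card = q ∧ pminorG B α < 0) :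
    ∃ α : Finset (Fin n), α.card = p ∧
      IsUnit (Matrix.det (Matrix.of fun a b : ↥α => B a b)) ∧
      (∀ β : Finset ↥(αᶜ), β.card = q - p → pminorG (schurCompl B α) β ≠ 0) ∧
      (∃ β : Finset ↥(αᶜ), β.card = q - p ∧ 0 < pminorG (schurCompl B α) β) ∧
      (∃ β : Finset ↥(αᶜ), β.card = q - p ∧ pminorG (schurCompl B α) β < 0) := by
  have hunit (α : Finset (Fin n)) (hα : α.card = p) :
      IsUnit (Matrix.det (Matrix.of fun a b : ↥α => B a b)) := by
    rw [isUnit_iff_ne_zero, ← hB.ofReal_pminorG]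
    exact_mod_cast hAp α hα
  have hrestrict (α γ : Finset (Fin n)) (hα : α.card = p) (hγ : γ.card = q) (hαγ : α ⊆ γ) :
      ∃ β : Finset ↥(αᶜ), β.card = q - p ∧
        pminorG B γ = pminorG B α * pminorG (schurCompl B α) β := by
    have hmap : (γ.subtype (· ∈ αᶜ)).map (Function.Embedding.subtype _) = γ \ α := by
      ext x
      simp
    refine ⟨γ.subtype (· ∈ αᶜ), ?_, pminorG_eq_mul_pminorG_schurCompl hB α (hunit α hα) _ γ ?_⟩
    · rw [← Finset.card_map (Function.Embedding.subtype _), hmap,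
        Finset.card_sdiff_of_subset hαγ, hα, hγ]
    · rw [hmap, Finset.union_sdiff_of_subset hαγ]
  obtain ⟨α, γ, δ, hα, hγ, hδ, hαγ, hαδ, hγpos, hδneg⟩ : ∃ α γ δ : Finset (Fin n),
      α.card = p ∧ γ.card = q ∧ δ.card = q ∧ α ⊆ γ ∧ α ⊆ δ ∧
        0 < pminorG B γ ∧ pminorG B δ < 0 := by
    by_contra! hcon
    obtain ⟨γ, hγ, hγpos⟩ := hpos
    obtain ⟨δ, hδ, hδneg⟩ := hneg
    refine hδneg.not_gt (Finset.forall_card_eq_of_common_subset hpq (P := (0 < pminorG B ·))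
      (fun α γ δ hα hγ hδ hαγ hαδ h => ?_) hγ hδ hγpos)
    exact (hcon α γ δ hα hγ hδ hαγ hαδ h).lt_of_ne' (hAq δ hδ)
  obtain ⟨β₁, hβ₁, h₁⟩ := hrestrict α γ hα hγ hαγ
  obtain ⟨β₂, hβ₂, h₂⟩ := hrestrict α δ hα hδ hαδ
  rw [h₁] at hγpos
  rw [h₂] at hδneg
  refine ⟨α, hα, hunit α hα, fun β hβ hzero => ?_, ?_⟩
  · refine hAq (α ∪ β.map (Function.Embedding.subtype _)) ?_ ?_
    · rw [Finset.card_union_of_disjoint, Finset.card_map]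
      · omega
      · rw [Finset.disjoint_left]
        rintro x hx hx'
        obtain ⟨b, -, rfl⟩ := Finset.mem_map.mp hx'
        exact Finset.mem_compl.mp b.2 hx
    · rw [pminorG_eq_mul_pminorG_schurCompl hB α (hunit α hα) β _ rfl, hzero, mul_zero]
  · rcases (hAp α hα).lt_or_gt with hneg' | hpos'
    · exact ⟨⟨β₂, hβ₂, pos_of_mul_neg_right hδneg hneg'.le⟩,
        ⟨β₁, hβ₁, neg_of_mul_pos_right hγpos hneg'.le⟩⟩
    · exact ⟨⟨β₁, hβ₁, pos_of_mul_pos_right hγpos hpos'.le⟩,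
        ⟨β₂, hβ₂, neg_of_mul_neg_right hδneg hpos'.le⟩⟩
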